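/- Let P_k be a probability distribution on 𝒳^k and let Q be a probability distribution on 𝒳 with Q(x) > 0 for all x ∈ 𝒳. Then KL(P_k ‖ Q^{⊗k}) = Σ_{i=1}^k KL(P_i ‖ Q) + Σ_{r=2}^k I^{(r)}(P_k), where I^{(r)}(P_k) is the total r-way interaction information of P_k. -/

import Mathlib

/-!
STATEMENT 1: `KL(P ‖ Q^{⊗k}) = Σ_{i=1}^k KL(P_i ‖ Q) + Σ_{r=2}^k I^{(r)}(P)`,
where `I^{(r)}(P)` is the total r-way interaction information of `P`.
-/

noncomputable section

open Finset

/-- Shannon entropy (base 2); `0 * log₂ 0 = 0` holds since `Real.logb 2 0 = 0`. -/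
def entropy {A : Type*} [Fintype A] (p : A → ℝ) : ℝ :=
  -∑ a, p a * Real.logb 2 (p a)

/-- Kullback–Leibler divergence (base 2); terms with `p a = 0` vanish. -/
def KL {A : Type*} [Fintype A] (p q : A → ℝ) : ℝ :=
  ∑ a, p a * Real.logb 2 (p a / q a)

/-- The `i`-th marginal of a distribution on `𝒳^k`. -/
def marginal {𝒳 : Type*} [Fintype 𝒳] [DecidableEq 𝒳] {k : ℕ}
    (P : (Fin k → 𝒳) → ℝ) (i : Fin k) : 𝒳 → ℝ :=
  fun x => ∑ y : Fin k → 𝒳, if y i = x then P y else 0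

/-- The marginal of `P` on the coordinates in `S ⊆ {1,…,k}`, a distribution on `𝒳^S`. -/
def margS {𝒳 : Type*} [Fintype 𝒳] [DecidableEq 𝒳] {k : ℕ}
    (P : (Fin k → 𝒳) → ℝ) (S : Finset (Fin k)) : ((i : S) → 𝒳) → ℝ :=
  fun z => ∑ y : Fin k → 𝒳, if ∀ i : S, y i = z i then P y else 0

/-- `H(X_S)`: Shannon entropy of the marginal on `S`. -/
def HS {𝒳 : Type*} [Fintype 𝒳] [DecidableEq 𝒳] {k : ℕ}
    (P : (Fin k → 𝒳) → ℝ) (S : Finset (Fin k)) : ℝ :=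
  entropy (margS P S)

/-- Interaction information `I(S) = −Σ_{T ⊆ S} (−1)^{|S|−|T|} H(X_T)`. -/
def II {𝒳 : Type*} [Fintype 𝒳] [DecidableEq 𝒳] {k : ℕ}
    (P : (Fin k → 𝒳) → ℝ) (S : Finset (Fin k)) : ℝ :=
  -∑ T ∈ S.powerset, (-1 : ℝ) ^ (S.card - T.card) * HS P T

/-- Total `r`-way interaction information `I^{(r)}(P) = Σ_{|S| = r} I(S)`. -/
def Ir {𝒳 : Type*} [Fintype 𝒳] [DecidableEq 𝒳] {k : ℕ}
    (P : (Fin k → 𝒳) → ℝ) (r : ℕ) : ℝ :=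
  ∑ S ∈ Finset.powersetCard r (Finset.univ : Finset (Fin k)), II P S

/-- Möbius inversion over the Boolean lattice, evaluated at the top element. -/
theorem sum_sum_powerset_neg_one_pow_mul {α : Type*} [Fintype α] [DecidableEq α]
    (f : Finset α → ℝ) :
    ∑ S : Finset α, ∑ T ∈ S.powerset, (-1 : ℝ) ^ (S.card - T.card) * f T = f univ := by
  have hT (T : Finset α) : ∑ S with T ⊆ S, (-1 : ℝ) ^ (S.card - T.card) =
      if T = univ then 1 else 0 := by
    have hbij : ∑ S with T ⊆ S, (-1 : ℝ) ^ (S.card - T.card) =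
        ∑ U ∈ Tᶜ.powerset, (-1 : ℝ) ^ U.card := by
      refine sum_nbij' (fun S => S \ T) (fun U => U ∪ T) ?_ ?_ ?_ ?_ ?_
      · intro S _
        simp only [mem_powerset, sdiff_eq_inter_compl]
        exact inter_subset_right
      · simp
      · intro S hS
        exact sdiff_union_of_subset (mem_filter.1 hS).2
      · intro U hU
        exact union_sdiff_cancel_right (le_compl_iff_disjoint_right.1 (mem_powerset.1 hU))
      · intro S hS
        rw [card_sdiff_of_subset (mem_filter.1 hS).2]
    have h := congrArg (Int.cast : ℤ → ℝ) (sum_powerset_neg_one_pow_card (x := Tᶜ))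
    push_cast at h
    rw [hbij, h]
    simp [compl_eq_empty_iff]
  rw [sum_comm' (t' := univ) (s' := fun T => univ.filter (T ⊆ ·)) (by simp)]
  simp [← sum_mul, hT]

theorem KL_eq_neg_entropy_sub {A : Type*} [Fintype A] (p q : A → ℝ) (hq : ∀ a, 0 < q a) :
    KL p q = -entropy p - ∑ a, p a * Real.logb 2 (q a) := by
  rw [KL, entropy, neg_neg, ← sum_sub_distrib]
  refine sum_congr rfl fun a _ => ?_
  rcases eq_or_ne (p a) 0 with h | h
  · simp [h]
  · rw [Real.logb_div h (hq a).ne', mul_sub]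

theorem entropy_comp_equiv {A B : Type*} [Fintype A] [Fintype B] (e : A ≃ B) (p : B → ℝ) :
    entropy (fun a => p (e a)) = entropy p := by
  rw [entropy, entropy, e.sum_comp (fun b => p b * Real.logb 2 (p b))]

section Marginals

variable {𝒳 : Type*} [Fintype 𝒳] [DecidableEq 𝒳] {k : ℕ} (P : (Fin k → 𝒳) → ℝ)

theorem sum_marginal_mul (i : Fin k) (g : 𝒳 → ℝ) :
    ∑ x, marginal P i x * g x = ∑ y, P y * g (y i) := by
  simp only [marginal, sum_mul, ite_mul, zero_mul]
  rw [sum_comm]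
  simp

theorem HS_univ : HS P univ = entropy P := by
  let e : ((i : (univ : Finset (Fin k))) → 𝒳) ≃ (Fin k → 𝒳) :=
    (Equiv.subtypeUnivEquiv fun i => mem_univ i).arrowCongr (Equiv.refl 𝒳)
  have h : margS P univ = fun z => P (e z) := by
    funext z
    have hz (y : Fin k → 𝒳) : (∀ i : (univ : Finset (Fin k)), y i = z i) ↔ y = e z :=
      ⟨fun h => funext fun i => h ⟨i, mem_univ i⟩, fun h i => congrFun h i⟩
    simp only [margS, hz, sum_ite_eq', mem_univ, if_true]
  rw [HS, h, entropy_comp_equiv]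

theorem HS_singleton (i : Fin k) : HS P {i} = entropy (marginal P i) := by
  let e : ((j : ({i} : Finset (Fin k))) → 𝒳) ≃ 𝒳 := Equiv.funUnique _ 𝒳
  have h : margS P {i} = fun z => marginal P i (e z) := by
    funext z
    have hz (y : Fin k → 𝒳) : (∀ j : ({i} : Finset (Fin k)), y j = z j) ↔ y i = e z :=
      Unique.forall_iff
    simp only [margS, marginal, hz]
  rw [HS, h, entropy_comp_equiv]

theorem HS_empty (hP : ∑ y, P y = 1) : HS P ∅ = 0 := by
  simp [HS, entropy, margS, hP]

theorem Ir_zero (hP : ∑ y, P y = 1) : Ir P 0 = 0 := by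
  simp [Ir, II, HS_empty P hP]

theorem Ir_one (hP : ∑ y, P y = 1) : Ir P 1 = -∑ i, entropy (marginal P i) := by
  have hI (i : Fin k) : II P {i} = -entropy (marginal P i) := by
    have hp : ({i} : Finset (Fin k)).powerset = {∅, {i}} := rfl
    rw [II, hp, sum_pair (singleton_ne_empty i).symm, HS_empty P hP, HS_singleton]
    simp
  simp [Ir, powersetCard_one, hI]

theorem sum_range_Ir : ∑ r ∈ range (k + 1), Ir P r = -entropy P := by
  rw [← HS_univ, ← sum_sum_powerset_neg_one_pow_mul (HS P), ← sum_neg_distrib, ← powerset_univ,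
    sum_powerset, card_univ, Fintype.card_fin]
  rfl

theorem sum_Icc_two_Ir (hk : 1 ≤ k) (hP : ∑ y, P y = 1) :
    ∑ r ∈ Icc 2 k, Ir P r = ∑ i, entropy (marginal P i) - entropy P := by
  have h := sum_range_Ir P
  rw [range_eq_Ico, sum_eq_sum_Ico_succ_bot (by omega), sum_eq_sum_Ico_succ_bot (by omega),
    Ir_zero P hP, Ir_one P hP] at h
  rw [← Ico_add_one_right_eq_Icc]
  linarith

end Marginals

theorem kl_decomposition_interaction_form
    {𝒳 : Type*} [Fintype 𝒳] [DecidableEq 𝒳] [Nonempty 𝒳] {k : ℕ} (hk : 1 ≤ k)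
    (P : (Fin k → 𝒳) → ℝ) (hP0 : ∀ y, 0 ≤ P y) (hP1 : ∑ y, P y = 1)
    (Q : 𝒳 → ℝ) (hQ0 : ∀ x, 0 < Q x) (hQ1 : ∑ x, Q x = 1) :
    KL P (fun y => ∏ i, Q (y i)) =
      (∑ i, KL (marginal P i) Q) + ∑ r ∈ Finset.Icc 2 k, Ir P r := by
  have hprod : ∀ y : Fin k → 𝒳, 0 < ∏ i, Q (y i) := fun y => prod_pos fun i _ => hQ0 (y i)
  have hlog : ∑ y, P y * Real.logb 2 (∏ i, Q (y i)) =
      ∑ i, ∑ x, marginal P i x * Real.logb 2 (Q x) := by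
    simp_rw [sum_marginal_mul P _ fun x => Real.logb 2 (Q x)]
    rw [sum_comm]
    refine sum_congr rfl fun y _ => ?_
    rw [Real.logb_prod _ _ fun i _ => (hQ0 (y i)).ne', mul_sum]
  rw [KL_eq_neg_entropy_sub P _ hprod, hlog, sum_Icc_two_Ir P hk hP1]
  simp_rw [KL_eq_neg_entropy_sub _ Q hQ0, sum_sub_distrib, sum_neg_distrib]
  ring
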